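/- Let φ : closure(X) → closure(Y) be a homeomorphism between closures of bounded open sets X, Y ⊆ ℝⁿ. Then for every ball B_r(x) with closure contained in X, the oscillation of φ over B_r(x) is at most the oscillation of φ over ∂B_r(x), i.e. sup{|φ(a) − φ(b)| : a, b ∈ B_r(x)} ≤ sup{|φ(a) − φ(b)| : a, b ∈ ∂B_r(x)}. -/

import Mathlib

open MeasureTheory Metric Set

lemma aux_poly {n : ℕ} (A : EuclideanSpace ℝ (Fin n) → (EuclideanSpace ℝ (Fin n) →L[ℝ] EuclideanSpace ℝ (Fin n)))
    (hA : Continuous A) :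
    ∃ p : Polynomial ℝ, ∀ t : ℝ,
      ∫ x in ball (0 : EuclideanSpace ℝ (Fin n)) 1, (ContinuousLinearMap.id ℝ _ + t • A x).det = p.eval t := by
  classical
  let b := (EuclideanSpace.basisFun (Fin n) ℝ).toBasis
  have hc : ∀ i j, Continuous fun x => LinearMap.toMatrix b b (A x : _ →ₗ[ℝ] _) i j := by
    intro i j
    simp only [LinearMap.toMatrix_apply]
    simp only [b, OrthonormalBasis.coe_toBasis, OrthonormalBasis.coe_toBasis_repr_apply, EuclideanSpace.basisFun_repr, ContinuousLinearMap.coe_coe]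
    fun_prop
  let M : Matrix (Fin n) (Fin n) C(EuclideanSpace ℝ (Fin n), ℝ) := fun i j => ⟨_, hc i j⟩
  let q : Polynomial C(EuclideanSpace ℝ (Fin n), ℝ) :=
    Matrix.det (1 + (Polynomial.X : Polynomial C(EuclideanSpace ℝ (Fin n), ℝ)) • M.map Polynomial.C)
  let ev : EuclideanSpace ℝ (Fin n) → (C(EuclideanSpace ℝ (Fin n), ℝ) →+* ℝ) := fun x =>
    { toFun := fun f => f x, map_one' := rfl, map_zero' := rfl, map_add' := fun _ _ => rfl, map_mul' := fun _ _ => rfl }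
  have hq : ∀ t x, (ContinuousLinearMap.id ℝ _ + t • A x).det = q.eval₂ (ev x) t := by
    intro t x
    have h1 : q.eval₂ (ev x) t = Polynomial.eval₂RingHom (ev x) t q := rfl
    rw [h1, RingHom.map_det, ContinuousLinearMap.det, ← LinearMap.det_toMatrix b]
    congr 1
    ext i j
    have h2 : ((ContinuousLinearMap.id ℝ (EuclideanSpace ℝ (Fin n)) + t • A x : _ →L[ℝ] _) : EuclideanSpace ℝ (Fin n) →ₗ[ℝ] EuclideanSpace ℝ (Fin n)) = LinearMap.id + t • (A x : _ →ₗ[ℝ] _) := rfl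
    rw [h2]
    simp only [map_add, map_smul, LinearMap.toMatrix_id]
    have hev : (ev x) (M i j) = LinearMap.toMatrix b b (A x : _ →ₗ[ℝ] _) i j := rfl
    by_cases hij : i = j
    · subst hij; simp [Matrix.map_apply, hev]; exact mul_comm _ _
    · simp [Matrix.map_apply, hev, hij]; exact mul_comm _ _
  refine ⟨∑ k ∈ Finset.range (q.natDegree + 1), Polynomial.monomial k (∫ x in ball (0 : EuclideanSpace ℝ (Fin n)) 1, q.coeff k x), fun t => ?_⟩
  simp only [hq, Polynomial.eval₂_eq_sum_range, Polynomial.eval_finsetSum, Polynomial.eval_monomial]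
  rw [integral_finsetSum]
  · refine Finset.sum_congr rfl fun k _ => ?_
    rw [← integral_mul_const]; rfl
  · intro k _
    have : Continuous fun x => (q.coeff k) x * t ^ k := by fun_prop
    exact ((this.continuousOn).integrableOn_compact (isCompact_closedBall (0 : EuclideanSpace ℝ (Fin n)) 1)).mono_set ball_subset_closedBall

lemma aux_proj {E : Type*} [NormedAddCommGroup E] [NormedSpace ℝ E] :
    LipschitzWith 2 (fun x : E => (max 1 ‖x‖)⁻¹ • x) := by
  refine LipschitzWith.of_dist_le_mul fun x y => ?_
  wlog h : max 1 ‖x‖ ≤ max 1 ‖y‖ generalizing x y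
  · have := this y x (le_of_not_ge h)
    rwa [dist_comm, dist_comm x y]
  set a := max 1 ‖x‖
  set b := max 1 ‖y‖
  have ha : 1 ≤ a := le_max_left _ _
  have hb : 1 ≤ b := le_max_left _ _
  have hyb : ‖y‖ ≤ b := le_max_right _ _
  have hba : b - a ≤ ‖x - y‖ := by
    have h1 : ‖y‖ ≤ ‖x‖ + ‖x - y‖ := by
      have := norm_sub_norm_le y x
      rw [norm_sub_rev] at this; linarith
    have : b ≤ a + ‖x - y‖ := max_le (by linarith [norm_nonneg (x-y)]) (by linarith [le_max_right 1 ‖x‖])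
    linarith
  have e : a⁻¹ • x - b⁻¹ • y = a⁻¹ • (x - y) + (a⁻¹ - b⁻¹) • y := by
    module
  rw [dist_eq_norm, dist_eq_norm, e]
  have hab : a⁻¹ - b⁻¹ = (b - a) / (a * b) := by field_simp
  have h1 : ‖a⁻¹ • (x - y)‖ ≤ ‖x - y‖ := by
    rw [norm_smul, Real.norm_of_nonneg (by positivity)]
    exact mul_le_of_le_one_left (norm_nonneg _) (inv_le_one_of_one_le₀ ha)
  have h2 : ‖(a⁻¹ - b⁻¹) • y‖ ≤ ‖x - y‖ := by
    rw [norm_smul, hab, Real.norm_of_nonneg (div_nonneg (by linarith) (by positivity))]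
    calc (b - a) / (a * b) * ‖y‖ ≤ (b - a) / (a * b) * b := by
          gcongr
      _ = (b - a) / a := by field_simp
      _ ≤ b - a := div_le_self (by linarith) ha
      _ ≤ _ := hba
  calc _ ≤ _ := norm_add_le _ _
    _ ≤ _ := by push_cast; linarith

lemma aux_noretract {n : ℕ} (N : EuclideanSpace ℝ (Fin n) → EuclideanSpace ℝ (Fin n))
    (hN : ContDiff ℝ 1 N) (h1 : ∀ x, ‖x‖ ≤ 1 → ‖N x‖ = 1) (h2 : ∀ x, ‖x‖ = 1 → N x = x) : False := by
  let g : EuclideanSpace ℝ (Fin n) → EuclideanSpace ℝ (Fin n) := fun x => N x - x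
  have hg : ContDiff ℝ 1 g := hN.sub contDiff_id
  let A := fun x => fderiv ℝ g x
  have hA : Continuous A := hg.continuous_fderiv (by norm_num)
  have hgA : ∀ x, HasFDerivAt g (A x) x := fun x => (hg.differentiable (by norm_num) x).hasFDerivAt
  obtain ⟨p, hp⟩ := aux_poly A hA
  obtain ⟨K, hK⟩ := (hg.contDiffOn (s := closedBall 0 1)).exists_lipschitzOnWith (by norm_num)
    (convex_closedBall _ _) (isCompact_closedBall _ _)
  obtain ⟨M, hM⟩ := (isCompact_closedBall (0 : EuclideanSpace ℝ (Fin n)) 1).exists_bound_of_continuousOn hA.continuousOn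
  -- positivity of the determinant near the identity
  obtain ⟨δ, hδ, hdet⟩ : ∃ δ > 0, ∀ B : EuclideanSpace ℝ (Fin n) →L[ℝ] EuclideanSpace ℝ (Fin n), ‖B‖ < δ →
      0 < (ContinuousLinearMap.id ℝ _ + B).det := by
    have hcont : Continuous fun B : EuclideanSpace ℝ (Fin n) →L[ℝ] EuclideanSpace ℝ (Fin n) =>
        (ContinuousLinearMap.id ℝ _ + B).det :=
      ContinuousLinearMap.continuous_det.comp (continuous_const.add continuous_id)
    have h0 : 0 < (fun B : EuclideanSpace ℝ (Fin n) →L[ℝ] EuclideanSpace ℝ (Fin n) =>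
        (ContinuousLinearMap.id ℝ _ + B).det) 0 := by
      simp [ContinuousLinearMap.det]
    have := hcont.continuousAt.eventually (lt_mem_nhds h0)
    obtain ⟨δ, hδ, h⟩ := Metric.eventually_nhds_iff.1 this
    exact ⟨δ, hδ, fun B hB => h (by simpa using hB)⟩
  -- the extended map
  let P : EuclideanSpace ℝ (Fin n) → EuclideanSpace ℝ (Fin n) := fun x => (max 1 ‖x‖)⁻¹ • x
  have hP1 : ∀ x, ‖x‖ ≤ 1 → P x = x := fun x hx => by simp [P, max_eq_left hx]
  have hP2 : ∀ x, 1 ≤ ‖x‖ → ‖P x‖ = 1 := fun x hx => by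
    simp only [P, max_eq_right hx, norm_smul, norm_inv, norm_norm]
    exact inv_mul_cancel₀ (by linarith)
  have hPm : ∀ x, P x ∈ closedBall (0 : EuclideanSpace ℝ (Fin n)) 1 := fun x => by
    rw [mem_closedBall_zero_iff]
    rcases le_total ‖x‖ 1 with h | h
    · rwa [hP1 x h]
    · exact (hP2 x h).le
  have hGL : ∀ x y, ‖g (P x) - g (P y)‖ ≤ (K * 2 : ℝ) * ‖x - y‖ := fun x y => by
    have e1 := hK.dist_le_mul _ (hPm x) _ (hPm y)
    have e2 := aux_proj.dist_le_mul x y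
    rw [dist_eq_norm] at e1
    rw [dist_eq_norm x y] at e2
    calc _ ≤ _ := e1
      _ ≤ K * (2 * ‖x - y‖) := by gcongr; exact e2
      _ = _ := by ring
  have hg0 : ∀ x, 1 ≤ ‖x‖ → g (P x) = 0 := fun x hx => by
    simp only [g]; rw [h2 _ (hP2 x hx), sub_self]
  obtain ⟨τ, hτ, hτ1, hτK, hτM⟩ : ∃ τ > (0:ℝ), τ < 1 ∧ τ * (K * 2) < 1 ∧ τ * |M| < δ := by
    have hc : Continuous fun τ : ℝ => (τ, τ * ((K:ℝ) * 2), τ * |M|) := by fun_prop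
    have e1 : ∀ᶠ τ : ℝ in nhdsWithin 0 (Ioi 0), τ < 1 :=
      nhdsWithin_le_nhds (gt_mem_nhds one_pos)
    have e2 : ∀ᶠ τ : ℝ in nhdsWithin 0 (Ioi 0), τ * (K * 2) < 1 :=
      nhdsWithin_le_nhds ((by fun_prop : Continuous fun τ : ℝ => τ * ((K:ℝ) * 2)).continuousAt.eventually
        (gt_mem_nhds (by simp)))
    have e3 : ∀ᶠ τ : ℝ in nhdsWithin 0 (Ioi 0), τ * |M| < δ :=
      nhdsWithin_le_nhds ((by fun_prop : Continuous fun τ : ℝ => τ * |M|).continuousAt.eventually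
        (gt_mem_nhds (by simpa using hδ)))
    obtain ⟨τ, ⟨⟨h1, h2⟩, h3⟩, h4⟩ := (((e1.and e2).and e3).and self_mem_nhdsWithin).exists
    exact ⟨τ, h4, h1, h2, h3⟩
  have hvol : ∀ t ∈ Ioo 0 τ, p.eval t = (volume (ball (0 : EuclideanSpace ℝ (Fin n)) 1)).toReal := by
    rintro t ⟨ht0, htτ⟩
    have htK : t * (K * 2) < 1 := lt_of_le_of_lt (by gcongr) hτK
    have htM : t * |M| < δ := lt_of_le_of_lt (by gcongr) hτM
    have hpos : ∀ x ∈ ball (0 : EuclideanSpace ℝ (Fin n)) 1, 0 < (ContinuousLinearMap.id ℝ _ + t • A x).det := by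
      intro x hx
      apply hdet
      rw [norm_smul, Real.norm_of_nonneg ht0.le]
      refine lt_of_le_of_lt ?_ htM
      gcongr
      exact (hM x (ball_subset_closedBall hx)).trans (le_abs_self _)
    let f : EuclideanSpace ℝ (Fin n) → EuclideanSpace ℝ (Fin n) := fun x => x + t • g x
    have hf' : ∀ x ∈ ball (0 : EuclideanSpace ℝ (Fin n)) 1,
        HasFDerivWithinAt f (ContinuousLinearMap.id ℝ _ + t • A x) (ball 0 1) x := fun x _ =>
      ((hasFDerivAt_id x).add ((hgA x).const_smul t)).hasFDerivWithinAt
    have hinjP : ∀ x y, x + t • g (P x) = y + t • g (P y) → x = y := by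
      intro x y hxy
      have e : x - y = - (t • (g (P x) - g (P y))) := by
        rw [smul_sub, neg_sub, sub_eq_sub_iff_add_eq_add, hxy, add_comm]
      have e2 : ‖x - y‖ ≤ t * (K * 2) * ‖x - y‖ := by
        calc ‖x - y‖ = t * ‖g (P x) - g (P y)‖ := by
              conv_lhs => rw [e, norm_neg, norm_smul, Real.norm_of_nonneg ht0.le]
          _ ≤ t * ((K * 2) * ‖x - y‖) := by gcongr; exact hGL x y
          _ = _ := by ring
      by_contra hne
      have : 0 < ‖x - y‖ := norm_pos_iff.2 (sub_ne_zero.2 hne)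
      nlinarith
    have hfP : ∀ x, ‖x‖ ≤ 1 → f x = x + t • g (P x) := fun x hx => by
      simp only [f, hP1 x hx]
    have hinj : InjOn f (ball 0 1) := by
      intro x hx y hy hxy
      rw [mem_ball_zero_iff] at hx hy
      rw [hfP x hx.le, hfP y hy.le] at hxy
      exact hinjP x y hxy
    have himg : f '' ball 0 1 = ball 0 1 := by
      apply Subset.antisymm
      · rintro _ ⟨x, hx, rfl⟩
        rw [mem_ball_zero_iff] at hx ⊢
        have e : f x = (1 - t) • x + t • N x := by simp only [f, g]; module
        rw [e]
        calc _ ≤ _ := norm_add_le _ _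
          _ = (1 - t) * ‖x‖ + t := by
            rw [norm_smul, norm_smul, Real.norm_of_nonneg ht0.le, Real.norm_of_nonneg (by linarith), h1 x hx.le, mul_one]
          _ < 1 := by nlinarith
      · intro y hy
        have hcon : ContractingWith ⟨t * (K * 2), by positivity⟩ (fun x => y - t • g (P x)) := by
          refine ⟨by exact_mod_cast htK, LipschitzWith.of_dist_le_mul fun a b => ?_⟩
          rw [dist_eq_norm, dist_eq_norm]
          have : y - t • g (P a) - (y - t • g (P b)) = -(t • (g (P a) - g (P b))) := by module
          rw [this, norm_neg, norm_smul, Real.norm_of_nonneg ht0.le]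
          calc _ ≤ t * ((K * 2) * ‖a - b‖) := by gcongr; exact hGL a b
            _ = (t * (K * 2)) * ‖a - b‖ := by ring
        have hfix := hcon.fixedPoint_isFixedPt
        set x := hcon.fixedPoint
        have hx : x + t • g (P x) = y := by
          have : y - t • g (P x) = x := hfix
          exact (sub_eq_iff_eq_add.1 this).symm
        have hx1 : ‖x‖ < 1 := by
          by_contra hx1
          push Not at hx1
          rw [hg0 x hx1, smul_zero, add_zero] at hx
          rw [mem_ball_zero_iff, ← hx] at hy
          linarith
        exact ⟨x, by simpa using hx1, by rw [hfP x hx1.le, hx]⟩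
    rw [← hp]
    have key := integral_image_eq_integral_abs_det_fderiv_smul volume measurableSet_ball hf' hinj (fun _ => (1:ℝ))
    rw [himg] at key
    have e : ∫ x in ball (0 : EuclideanSpace ℝ (Fin n)) 1, (ContinuousLinearMap.id ℝ _ + t • A x).det =
        ∫ x in ball (0 : EuclideanSpace ℝ (Fin n)) 1, |(ContinuousLinearMap.id ℝ _ + t • A x).det| • (1:ℝ) := by
      refine setIntegral_congr_fun measurableSet_ball fun x hx => ?_
      simp [abs_of_pos (hpos x hx)]
    rw [e, ← key]
    simp [Measure.real]
  have hpc : p = Polynomial.C (volume (ball (0 : EuclideanSpace ℝ (Fin n)) 1)).toReal := by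
    apply Polynomial.eq_of_infinite_eval_eq
    refine (Ioo_infinite hτ).mono fun t ht => ?_
    simp only [mem_ofPred_eq, Polynomial.eval_C]
    exact hvol t ht
  have hv : 0 < (volume (ball (0 : EuclideanSpace ℝ (Fin n)) 1)).toReal :=
    ENNReal.toReal_pos (measure_ball_pos _ _ one_pos).ne' measure_ball_lt_top.ne
  have hz := hp 1
  rw [hpc, Polynomial.eval_C] at hz
  rw [← hz] at hv
  refine hv.ne' ?_
  rw [setIntegral_congr_fun (g := fun _ => (0:ℝ)) measurableSet_ball, integral_zero]
  intro x hx
  simp only [one_smul]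
  have hd : HasFDerivAt N (ContinuousLinearMap.id ℝ _ + A x) x := by
    have := (hasFDerivAt_id x).add (hgA x)
    have e : N = id + g := by funext y; simp [g]
    rw [e]; exact this
  by_contra hne
  have hsurj : Function.Surjective (fun v => (ContinuousLinearMap.id ℝ (EuclideanSpace ℝ (Fin n)) + A x) v) := by
    have : IsUnit (LinearMap.det ((ContinuousLinearMap.id ℝ _ + A x : _ →L[ℝ] _) : EuclideanSpace ℝ (Fin n) →ₗ[ℝ] EuclideanSpace ℝ (Fin n))) := isUnit_iff_ne_zero.2 hne
    have hu := (LinearMap.isUnit_iff_isUnit_det _).2 this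
    exact ((Module.End.isUnit_iff _).1 hu).2
  obtain ⟨v, hv⟩ := hsurj (N x)
  have hi := hd.inner ℝ hd
  have hcst : HasFDerivAt (fun y => inner ℝ (N y) (N y)) (0 : EuclideanSpace ℝ (Fin n) →L[ℝ] ℝ) x := by
    refine (hasFDerivAt_const (1:ℝ) x).congr_of_eventuallyEq ?_
    filter_upwards [isOpen_ball.mem_nhds hx] with y hy
    rw [real_inner_self_eq_norm_sq, h1 y (by simpa using (mem_ball_zero_iff.1 hy).le)]; norm_num
  have := congrArg (fun L => L v) (hi.unique hcst)
  simp only [ContinuousLinearMap.comp_apply, ContinuousLinearMap.prod_apply, fderivInnerCLM_apply, hv, zero_apply] at this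
  rw [real_inner_self_eq_norm_sq, h1 x (mem_ball_zero_iff.1 hx).le] at this
  norm_num at this

lemma aux_zero {n : ℕ} (F : EuclideanSpace ℝ (Fin n) → EuclideanSpace ℝ (Fin n))
    (hF : Continuous F) (h : ∀ x, ‖x‖ ≤ 1 → ‖F x - x‖ ≤ 1 / 2) : ∃ x, ‖x‖ ≤ 1 ∧ F x = 0 := by
  by_contra hcon
  push Not at hcon
  obtain ⟨x0, hx0, hmin⟩ := (isCompact_closedBall (0 : EuclideanSpace ℝ (Fin n)) 1).exists_isMinOn
    ⟨0, by simp⟩ hF.norm.continuousOn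
  have hm : 0 < ‖F x0‖ := norm_pos_iff.2 (hcon x0 (by simpa using hx0))
  set m := ‖F x0‖
  obtain ⟨S, hS, hSF, -⟩ := hF.exists_contDiff_approx (ε := fun _ => min m (1/4)) 1 continuous_const
    (fun _ => by positivity)
  have hS1 : ∀ x, ‖x‖ ≤ 1 → ‖S x - x‖ < 3 / 4 := fun x hx => by
    have e1 := lt_of_lt_of_le (hSF x) (min_le_right _ _)
    rw [dist_eq_norm] at e1
    have e2 := norm_add_le (S x - F x) (F x - x)
    rw [sub_add_sub_cancel] at e2
    linarith [h x hx]
  have hS2 : ∀ x, ‖x‖ ≤ 1 → S x ≠ 0 := fun x hx h0 => by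
    have e1 := lt_of_lt_of_le (hSF x) (min_le_left _ _)
    rw [h0, dist_zero_left] at e1
    have e2 : m ≤ ‖F x‖ := hmin (show x ∈ closedBall 0 1 by simpa using hx)
    linarith
  let χ : ContDiffBump (0 : EuclideanSpace ℝ (Fin n)) := ⟨4/5, 9/10, by norm_num, by norm_num⟩
  let T : EuclideanSpace ℝ (Fin n) → EuclideanSpace ℝ (Fin n) := fun x => x + χ x • (S x - x)
  have hT : ContDiff ℝ 1 T := contDiff_id.add (χ.contDiff.smul (hS.sub contDiff_id))
  have hTout : ∀ x, 9/10 ≤ ‖x‖ → T x = x := fun x hx => by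
    have : χ x = 0 := χ.zero_of_le_dist (by simpa [χ] using hx)
    simp [T, this]
  have hTin : ∀ x, ‖x‖ ≤ 4/5 → T x = S x := fun x hx => by
    have : χ x = 1 := χ.one_of_mem_closedBall (by simpa [χ] using hx)
    simp [T, this]
  have hT0 : ∀ x, T x ≠ 0 := fun x h0 => by
    rcases le_total ‖x‖ (4/5) with hx | hx
    · exact hS2 x (by linarith) (by rw [← hTin x hx, h0])
    rcases le_total (9/10) ‖x‖ with hx' | hx'
    · rw [hTout x hx'] at h0
      rw [h0, norm_zero] at hx'; norm_num at hx'
    · have e : x = - (χ x • (S x - x)) := eq_neg_of_add_eq_zero_left h0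
      have e2 : ‖x‖ = χ x * ‖S x - x‖ := by
        conv_lhs => rw [e]
        rw [norm_neg, norm_smul, Real.norm_of_nonneg χ.nonneg]
      have e3 := hS1 x (by linarith)
      have e4 : χ x ≤ 1 := χ.le_one
      have e5 : χ x * ‖S x - x‖ ≤ 1 * ‖S x - x‖ := by gcongr
      linarith
  refine aux_noretract (fun x => ‖T x‖⁻¹ • T x) (((hT.norm ℝ hT0).inv (fun x => norm_ne_zero_iff.2 (hT0 x))).smul hT)
    (fun x _ => ?_) (fun x hx => ?_)
  · rw [norm_smul, norm_inv, norm_norm, inv_mul_cancel₀ (norm_ne_zero_iff.2 (hT0 x))]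
  · simp only [hTout x (by rw [hx]; norm_num), hx, inv_one, one_smul]

lemma aux_extremal {n : ℕ} (f : EuclideanSpace ℝ (Fin n) → EuclideanSpace ℝ (Fin n))
    (hf : Continuous f) (hinj : InjOn f (closedBall 0 1)) (c : EuclideanSpace ℝ (Fin n))
    (hne : f 0 ≠ c) (hmax : ∀ x, ‖x‖ ≤ 1 → ‖f x - c‖ ≤ ‖f 0 - c‖) : False := by
  -- the left inverse, extended
  obtain ⟨G, hG⟩ : ∃ G : C(EuclideanSpace ℝ (Fin n), EuclideanSpace ℝ (Fin n)), ∀ x, ‖x‖ ≤ 1 → G (f x) = x := by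
    have : CompactSpace (closedBall (0 : EuclideanSpace ℝ (Fin n)) 1) :=
      isCompact_iff_compactSpace.1 (isCompact_closedBall _ _)
    have he : Topology.IsClosedEmbedding (fun x : closedBall (0 : EuclideanSpace ℝ (Fin n)) 1 => f x) :=
      (hf.comp continuous_subtype_val).isClosedEmbedding (fun x y hxy => Subtype.ext (hinj x.2 y.2 hxy))
    obtain ⟨G, hG⟩ := ContinuousMap.exists_extension' he
      (⟨Subtype.val, continuous_subtype_val⟩ : C(closedBall (0 : EuclideanSpace ℝ (Fin n)) 1, EuclideanSpace ℝ (Fin n)))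
    exact ⟨G, fun x hx => congrFun hG ⟨x, by simpa using hx⟩⟩
  set q := f 0 with hq
  have hGq : G q = 0 := hG 0 (by simp)
  set D := ‖q - c‖ with hD
  have hDpos : 0 < D := norm_pos_iff.2 (sub_ne_zero.2 hne)
  obtain ⟨v, hv⟩ : ∃ v, v = D⁻¹ • (q - c) := ⟨_, rfl⟩
  have hv1 : ‖v‖ = 1 := by
    rw [hv, norm_smul, norm_inv, Real.norm_of_nonneg hDpos.le, inv_mul_cancel₀ hDpos.ne']
  have hvv : inner ℝ v v = (1:ℝ) := by rw [real_inner_self_eq_norm_sq, hv1]; norm_num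
  have hDv : q - c = D • v := by rw [hv, smul_smul, mul_inv_cancel₀ hDpos.ne', one_smul]
  have hest : ∀ x, ‖x‖ ≤ 1 → ‖f x - q‖ ^ 2 ≤ - (2 * D * inner ℝ (f x - q) v) := by
    intro x hx
    have e := hmax x hx
    have e1 : f x - c = (f x - q) + D • v := by rw [← hDv]; abel
    have e2 : ‖f x - c‖ ^ 2 = ‖f x - q‖ ^ 2 + 2 * (D * inner ℝ (f x - q) v) + D ^ 2 := by
      rw [e1, norm_add_sq_real, inner_smul_right, norm_smul, hv1, mul_one, Real.norm_of_nonneg hDpos.le]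
    have e3 : ‖f x - c‖ ^ 2 ≤ D ^ 2 := by gcongr
    nlinarith
  have hle : ∀ x, ‖x‖ ≤ 1 → inner ℝ (f x - q) v ≤ 0 := by
    intro x hx
    have := hest x hx
    by_contra hc
    push Not at hc
    have : 0 < 2 * D * inner ℝ (f x - q) v := by positivity
    nlinarith [sq_nonneg ‖f x - q‖]
  obtain ⟨δ, hδ, hGδ⟩ : ∃ δ > 0, ∀ y, ‖y - q‖ < 3 * δ → ‖G y‖ < 1 / 8 := by
    obtain ⟨δ, hδ, h⟩ := Metric.continuous_iff.1 G.continuous q (1/8) (by norm_num)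
    refine ⟨δ / 3, by positivity, fun y hy => ?_⟩
    have := h y (by rw [dist_eq_norm]; linarith)
    rwa [hGq, dist_zero_right] at this
  obtain ⟨ε, hε, hεδ, hεD⟩ : ∃ ε > 0, ε ≤ δ ∧ 2 * D * ε ≤ δ ^ 2 := by
    refine ⟨min δ (δ ^ 2 / (2 * D)), by positivity, min_le_left _ _, ?_⟩
    calc 2 * D * min δ (δ ^ 2 / (2 * D)) ≤ 2 * D * (δ ^ 2 / (2 * D)) := by gcongr; exact min_le_right _ _
      _ = δ ^ 2 := by field_simp
  have hnear : ∀ x, ‖x‖ ≤ 1 → -ε ≤ inner ℝ (f x - q) v → ‖f x - q‖ ≤ δ := by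
    intro x hx hi
    have := hest x hx
    refine abs_le_of_sq_le_sq' ?_ hδ.le |>.2
    nlinarith
  -- push into the half space
  let Φ : EuclideanSpace ℝ (Fin n) → EuclideanSpace ℝ (Fin n) := fun y => y - max 0 (inner ℝ (y - q) v + ε) • v
  have hΦ : Continuous Φ := by fun_prop
  have hΦ1 : ∀ y, inner ℝ (y - q) v ≤ -ε → Φ y = y := fun y hy => by
    simp only [Φ]; rw [max_eq_left (by linarith), zero_smul, sub_zero]
  have hΦ2 : ∀ y, -ε ≤ inner ℝ (y - q) v → inner ℝ (Φ y - q) v = -ε := fun y hy => by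
    simp only [Φ]
    rw [max_eq_right (by linarith), sub_right_comm, inner_sub_left, real_inner_smul_left, hvv]; ring
  have hGΦ : ∀ x, ‖x‖ ≤ 1 → ‖G (Φ (f x)) - x‖ ≤ 1 / 4 := by
    intro x hx
    rcases le_total (inner ℝ (f x - q) v) (-ε) with h | h
    · rw [hΦ1 _ h, hG x hx, sub_self, norm_zero]; norm_num
    · have e1 := hnear x hx h
      have e2 : ‖Φ (f x) - q‖ < 3 * δ := by
        have : Φ (f x) - q = (f x - q) - max 0 (inner ℝ (f x - q) v + ε) • v := by
          simp only [Φ]; abel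
        rw [this]
        refine (norm_sub_le _ _).trans_lt ?_
        rw [norm_smul, hv1, mul_one, Real.norm_of_nonneg (le_max_left _ _)]
        have : max 0 (inner ℝ (f x - q) v + ε) ≤ ε := max_le hε.le (by linarith [hle x hx])
        linarith
      have e3 := hGδ _ e2
      have e4 := hGδ (f x) (by linarith)
      rw [hG x hx] at e4
      linarith [norm_sub_le (G (Φ (f x))) x]
  -- lower bound on the fixed part
  obtain ⟨m, hm, hmb⟩ : ∃ m > 0, ∀ x, ‖x‖ ≤ 1 → inner ℝ (f x - q) v ≤ -ε → m ≤ ‖x‖ := by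
    obtain ⟨m, hm, h⟩ := Metric.continuous_iff.1 hf 0 ε hε
    refine ⟨m, hm, fun x hx hi => ?_⟩
    by_contra hc
    push Not at hc
    have e := h x (by simpa using hc)
    rw [dist_eq_norm, ← hq] at e
    have := abs_real_inner_le_norm (f x - q) v
    rw [hv1, mul_one] at this
    linarith [neg_abs_le (inner ℝ (f x - q) v)]
  obtain ⟨S, hS, hSG, -⟩ := G.continuous.exists_contDiff_approx (ε := fun _ => min (m/4) (1/16)) 1 continuous_const
    (fun _ => by positivity)
  -- the hyperplane has null image
  let W : Submodule ℝ (EuclideanSpace ℝ (Fin n)) := LinearMap.ker ((innerSL ℝ v : EuclideanSpace ℝ (Fin n) →L[ℝ] ℝ) : EuclideanSpace ℝ (Fin n) →ₗ[ℝ] ℝ)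
  have hW : W ≠ ⊤ := by
    intro h
    have : v ∈ W := by rw [h]; trivial
    have h0 : inner ℝ v v = (0:ℝ) := by simpa [W] using this
    rw [hvv] at h0; norm_num at h0
  let S' : EuclideanSpace ℝ (Fin n) → EuclideanSpace ℝ (Fin n) := fun w => S (w + (q - ε • v))
  have hnull : volume (S' '' (W : Set (EuclideanSpace ℝ (Fin n)))) = 0 := by
    apply addHaar_image_eq_zero_of_differentiableOn_of_addHaar_eq_zero
    · have : ContDiff ℝ 1 S' := hS.comp (contDiff_id.add contDiff_const)
      exact (this.differentiable (by norm_num)).differentiableOn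
    · exact Measure.addHaar_submodule _ _ hW
  obtain ⟨k, hk, hkW⟩ : ∃ k ∈ ball (0 : EuclideanSpace ℝ (Fin n)) (min (m/4) (1/16)), k ∉ S' '' (W : Set (EuclideanSpace ℝ (Fin n))) := by
    by_contra hc
    push Not at hc
    have := measure_mono_null (show ball (0 : EuclideanSpace ℝ (Fin n)) (min (m/4) (1/16)) ⊆ _ from hc) hnull
    exact (measure_ball_pos _ _ (by positivity)).ne' this
  rw [mem_ball_zero_iff] at hk
  have hk1 := hk.trans_le (min_le_left _ _)
  have hk2 := hk.trans_le (min_le_right _ _)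
  have hclose : ∀ y, ‖S y - k - G y‖ ≤ ‖S y - G y‖ + ‖k‖ := fun y => by
    rw [sub_right_comm]; exact norm_sub_le _ _
  obtain ⟨x, hx, hx0⟩ := aux_zero (fun x => S (Φ (f x)) - k)
    (((hS.continuous.comp hΦ).comp hf).sub continuous_const) (by
      intro x hx
      have e1 := hGΦ x hx
      have e2 := (hSG (Φ (f x))).trans_le (min_le_right _ _)
      rw [dist_eq_norm] at e2
      have e3 := hclose (Φ (f x))
      have e4 := norm_add_le (S (Φ (f x)) - k - G (Φ (f x))) (G (Φ (f x)) - x)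
      rw [sub_add_sub_cancel] at e4
      linarith)
  rcases le_total (inner ℝ (f x - q) v) (-ε) with h | h
  · have e1 := hmb x hx h
    rw [hΦ1 _ h] at hx0
    have e2 := hclose (f x)
    rw [hx0, hG x hx, zero_sub, norm_neg] at e2
    have e3 := (hSG (f x)).trans_le (min_le_left _ _)
    rw [dist_eq_norm, hG x hx] at e3
    linarith
  · refine hkW ⟨Φ (f x) - (q - ε • v), ?_, ?_⟩
    · have := hΦ2 _ h
      have e : inner ℝ v (Φ (f x) - (q - ε • v)) = (0:ℝ) := by
        rw [real_inner_comm, ← sub_add, inner_add_left, this, real_inner_smul_left, hvv]; ring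
      simpa [W] using e
    · simp only [S', sub_add_cancel]
      exact sub_eq_zero.1 hx0

lemma aux_sphere {n : ℕ} (φ : EuclideanSpace ℝ (Fin n) → EuclideanSpace ℝ (Fin n))
    (x : EuclideanSpace ℝ (Fin n)) (r : ℝ)
    (hc : ContinuousOn φ (closedBall x r)) (hi : InjOn φ (closedBall x r))
    (a c : EuclideanSpace ℝ (Fin n)) (ha : a ∈ closedBall x r) (hne : φ a ≠ c)
    (hmax : ∀ y ∈ closedBall x r, dist (φ y) c ≤ dist (φ a) c) : a ∈ sphere x r := by
  by_contra hs
  have hlt : dist a x < r := lt_of_le_of_ne ha hs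
  obtain ⟨s, hs0⟩ : ∃ s, s = r - dist a x := ⟨_, rfl⟩
  have hspos : 0 < s := by linarith
  let P : EuclideanSpace ℝ (Fin n) → EuclideanSpace ℝ (Fin n) := fun x => (max 1 ‖x‖)⁻¹ • x
  have hP1 : ∀ x, ‖x‖ ≤ 1 → P x = x := fun x hx => by simp [P, max_eq_left hx]
  have hPc : Continuous P := aux_proj.continuous
  have hPm : ∀ x, ‖P x‖ ≤ 1 := fun x => by
    simp only [P, norm_smul, norm_inv]
    rw [Real.norm_of_nonneg (by positivity)]
    exact inv_mul_le_one_of_le₀ (le_max_right _ _) (by positivity)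
  have hmem : ∀ y, ‖y‖ ≤ 1 → a + s • y ∈ closedBall x r := fun y hy => by
    rw [mem_closedBall, dist_eq_norm, add_sub_right_comm]
    refine (norm_add_le _ _).trans ?_
    rw [norm_smul, Real.norm_of_nonneg hspos.le, ← dist_eq_norm]
    nlinarith
  refine aux_extremal (fun y => φ (a + s • P y)) ?_ ?_ c ?_ ?_
  · exact hc.comp_continuous (by fun_prop) (fun y => hmem _ (hPm y))
  · intro y hy z hz hyz
    rw [mem_closedBall_zero_iff] at hy hz
    simp only [hP1 y hy, hP1 z hz] at hyz
    have := hi (hmem y hy) (hmem z hz) hyz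
    exact smul_right_injective _ hspos.ne' (add_left_cancel this)
  · simpa [P] using hne
  · intro y hy
    have := hmax _ (hmem _ (hPm y))
    rw [dist_eq_norm, dist_eq_norm] at this
    simpa [P] using this

lemma aux_max {α β : Type*} [TopologicalSpace α] [PseudoMetricSpace β] (φ : α → β) (K : Set α)
    (hK : IsCompact K) (hn : K.Nonempty) (hc : ContinuousOn φ K) :
    ∃ a ∈ K, ∃ b ∈ K, ∀ y ∈ K, ∀ z ∈ K, dist (φ y) (φ z) ≤ dist (φ a) (φ b) := by
  have hL : IsCompact (φ '' K) := hK.image_of_continuousOn hc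
  have hLn : ((φ '' K) ×ˢ (φ '' K)).Nonempty := (hn.image φ).prod (hn.image φ)
  obtain ⟨p, hp, hmax⟩ := (hL.prod hL).exists_isMaxOn hLn
    (continuous_dist (α := β)).continuousOn
  obtain ⟨a, ha, ha'⟩ := hp.1
  obtain ⟨b, hb, hb'⟩ := hp.2
  refine ⟨a, ha, b, hb, fun y hy z hz => ?_⟩
  rw [ha', hb']
  exact isMaxOn_iff.1 hmax (φ y, φ z) (mk_mem_prod (mem_image_of_mem φ hy) (mem_image_of_mem φ hz))

/-- For a homeomorphism `φ` between closures of bounded open sets, the oscillation of `φ`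
over a ball compactly contained in `X` is at most its oscillation over the boundary sphere. -/
theorem stmt_4 {n : ℕ} (X Y : Set (EuclideanSpace ℝ (Fin n)))
    (hXo : IsOpen X) (hYo : IsOpen Y)
    (hXb : Bornology.IsBounded X) (hYb : Bornology.IsBounded Y)
    (φ : EuclideanSpace ℝ (Fin n) → EuclideanSpace ℝ (Fin n))
    (hφcont : ContinuousOn φ (closure X)) (hφinj : Set.InjOn φ (closure X))
    (hφsurj : φ '' closure X = closure Y)
    (x : EuclideanSpace ℝ (Fin n)) (r : ℝ) (hr : 0 < r)
    (hball : closure (Metric.ball x r) ⊆ X) :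
    Metric.diam (φ '' Metric.ball x r) ≤ Metric.diam (φ '' Metric.sphere x r) := by
  have hsub : closedBall x r ⊆ closure X := by
    rw [← closure_ball x hr.ne']
    exact hball.trans subset_closure
  have hc : ContinuousOn φ (closedBall x r) := hφcont.mono hsub
  have hi : InjOn φ (closedBall x r) := hφinj.mono hsub
  have hK : IsCompact (closedBall x r) := isCompact_closedBall x r
  obtain ⟨a, ha, b, hb, hmax'⟩ := aux_max φ (closedBall x r) hK ⟨x, mem_closedBall_self hr.le⟩ hc
  have hD : dist (φ a) (φ b) ≤ diam (φ '' sphere x r) := by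
    by_cases hne : φ a = φ b
    · rw [hne, dist_self]; exact diam_nonneg
    have has : a ∈ sphere x r := aux_sphere φ x r hc hi a (φ b) ha hne (fun y hy => hmax' y hy b hb)
    have hbs : b ∈ sphere x r := aux_sphere φ x r hc hi b (φ a) hb (Ne.symm hne)
      (fun y hy => by rw [dist_comm (φ b)]; exact hmax' y hy a ha)
    refine dist_le_diam_of_mem ?_ (mem_image_of_mem φ has) (mem_image_of_mem φ hbs)
    exact ((isCompact_sphere x r).image_of_continuousOn (hc.mono sphere_subset_closedBall)).isBounded
  refine (diam_le_of_forall_dist_le dist_nonneg ?_).trans hD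
  rintro _ ⟨y, hy, rfl⟩ _ ⟨z, hz, rfl⟩
  exact hmax' y (ball_subset_closedBall hy) z (ball_subset_closedBall hz)
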